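/- arXiv:2009.03183 — 2 statements merged into one kernel-verified Lean document; each statement's English description precedes it below -/
import Mathlib

section
/- With Y ~ N(μ, σ²) and E(Y|X) = tanh((μ/σ²)Y)·Y (as a function of Y through |Y| = √(tan X)), the squared correlation satisfies ρ(E(Y|X), Y)² = 1 - E[(Y/σ)²(1 - tanh((μ/σ²)Y))]. -/
open MeasureTheory ProbabilityTheory
open scoped NNReal ENNReal

/-- Density of the Gaussian distribution `N(m, s²)`. -/
noncomputable def gpdf (m s y : ℝ) : ℝ :=
  (1 / (s * Real.sqrt (2 * Real.pi))) * Real.exp (-(y - m) ^ 2 / (2 * s ^ 2))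

/-- Covariance of two real random variables: `Cov(U,V) = E(UV) - E(U)E(V)`. -/
noncomputable def cov {Ω : Type*} [MeasurableSpace Ω] (μ : Measure Ω) (U V : Ω → ℝ) : ℝ :=
  (∫ ω, U ω * V ω ∂μ) - (∫ ω, U ω ∂μ) * (∫ ω, V ω ∂μ)

/-- Pearson correlation coefficient `ρ(U,V) = Cov(U,V)/(σ_U σ_V)`. -/
noncomputable def pearson {Ω : Type*} [MeasurableSpace Ω] (μ : Measure Ω) (U V : Ω → ℝ) : ℝ :=
  cov μ U V / (Real.sqrt (variance U μ) * Real.sqrt (variance V μ))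

theorem measurable_real_tan : Measurable Real.tan := by
  have h : Real.tan = fun x => Real.sin x / Real.cos x := funext Real.tan_eq_sin_div_cos
  rw [h]
  fun_prop

theorem measurable_real_tanh : Measurable Real.tanh := by
  have h : Real.tanh = fun x => Real.sinh x / Real.cosh x := funext Real.tanh_eq_sinh_div_cosh
  rw [h]
  fun_prop

theorem even_tanh_mul (c : ℝ) : Function.Even fun y : ℝ => Real.tanh (c * y) * y := fun y => by
  simp only [mul_neg, Real.tanh_neg, neg_mul, neg_neg]

theorem Function.Odd.integral_eq_zero {f : ℝ → ℝ} (hf : Function.Odd f) : ∫ x, f x = 0 := by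
  have h := integral_neg_eq_self f volume
  simp only [hf _, integral_neg] at h
  linarith

/-- Under `N(m, v)`, the function `y ↦ y * tanh (m y / v)` has the same integral as the identity
against every even weight. -/
theorem integral_even_mul_sub_tanh_gaussianReal (m : ℝ) {v : ℝ≥0} (hv : v ≠ 0) {k : ℝ → ℝ}
    (hk : Function.Even k) :
    ∫ y, k y * (y - Real.tanh (m / v * y) * y) ∂gaussianReal m v = 0 := by
  rw [integral_gaussianReal_eq_integral_smul hv]
  refine Function.Odd.integral_eq_zero ?_
  have hv' : (v : ℝ) ≠ 0 := by exact_mod_cast hv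
  have key : ∀ y : ℝ, gaussianPDFReal m v y • (k y * (y - Real.tanh (m / v * y) * y)) =
      (√(2 * Real.pi * v))⁻¹ * Real.exp (-(y ^ 2 + m ^ 2) / (2 * v)) * k y
        * (y / Real.cosh (m / v * y)) := by
    intro y
    have hexp : Real.exp (-(y - m) ^ 2 / (2 * v)) =
        Real.exp (-(y ^ 2 + m ^ 2) / (2 * v)) * Real.exp (m / v * y) := by
      rw [← Real.exp_add]
      congr 1
      field_simp
      ring
    have hcosh := (Real.cosh_pos (m / v * y)).ne'
    have htanh : Real.exp (m / v * y) * (1 - Real.tanh (m / v * y)) =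
        1 / Real.cosh (m / v * y) := by
      rw [Real.tanh_eq_sinh_div_cosh, one_sub_div hcosh, Real.cosh_sub_sinh, ← mul_div_assoc,
        ← Real.exp_add, add_neg_cancel, Real.exp_zero]
    rw [gaussianPDFReal, hexp, smul_eq_mul]
    linear_combination (√(2 * Real.pi * v))⁻¹ * Real.exp (-(y ^ 2 + m ^ 2) / (2 * v)) * k y * y
      * htanh
  intro y
  simp only [key]
  rw [hk y, neg_sq, mul_neg, Real.cosh_neg]
  ring

theorem integrable_tanh_mul {Ω : Type*} [MeasurableSpace Ω] {μ : Measure Ω} {f : Ω → ℝ}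
    (hf : Integrable f μ) {g : Ω → ℝ} (hg : Measurable g) :
    Integrable (fun ω => Real.tanh (g ω) * f ω) μ :=
  hf.bdd_mul (c := 1) (measurable_real_tanh.comp hg).aestronglyMeasurable
    (ae_of_all _ fun ω => (Real.abs_tanh_lt_one (g ω)).le)

/-- Observing `Y` Gaussian through `arctan (Y ^ 2) + U π`, with `U` an independent Bernoulli
variable, amounts to forgetting the sign of `Y`. -/
theorem condExp_comap_arctan_sq_add {Ω : Type*} [MeasurableSpace Ω] {μ : Measure Ω}
    [IsProbabilityMeasure μ] {Y U : Ω → ℝ} {m : ℝ} {v : ℝ≥0} (hv : v ≠ 0)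
    (hYm : Measurable Y) (hUm : Measurable U) (hY : μ.map Y = gaussianReal m v)
    (hU : ∀ᵐ ω ∂μ, U ω = 0 ∨ U ω = 1) (hindep : IndepFun U Y μ) :
    (fun ω => Real.tanh (m / v * Y ω) * Y ω) =ᵐ[μ]
      μ[Y | MeasurableSpace.comap (fun ω => Real.arctan (Y ω ^ 2) + U ω * Real.pi)
        inferInstance] := by
  have hid : Integrable (fun y : ℝ => y) (gaussianReal m v) :=
    (memLp_id_gaussianReal' 1 (by simp)).integrable le_rfl
  have hYint : Integrable Y μ := by
    rw [← hY] at hid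
    exact hid.comp_measurable hYm
  have hZint : Integrable (fun ω => Real.tanh (m / v * Y ω) * Y ω) μ :=
    integrable_tanh_mul hYint (by fun_prop)
  have hXm : Measurable fun ω => Real.arctan (Y ω ^ 2) + U ω * Real.pi := by fun_prop
  refine ae_eq_condExp_of_forall_setIntegral_eq hXm.comap_le hYint
    (fun s _ _ => hZint.integrableOn) ?_ ?_
  · rintro s ⟨B, hB, rfl⟩ -
    have hs := hXm hB
    rw [eq_comm, ← sub_eq_zero, ← integral_sub hYint.integrableOn hZint.integrableOn,
      ← integral_indicator hs]
    set T : Set (ℝ × ℝ) := {p | Real.arctan (p.2 ^ 2) + p.1 * Real.pi ∈ B}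
    have hTm : MeasurableSet T :=
      (show Measurable fun p : ℝ × ℝ => Real.arctan (p.2 ^ 2) + p.1 * Real.pi by fun_prop) hB
    set F : ℝ × ℝ → ℝ := T.indicator fun p => p.2 - Real.tanh (m / v * p.2) * p.2
    have hFm : Measurable F := by
      refine Measurable.indicator (measurable_snd.sub (Measurable.mul ?_ measurable_snd)) hTm
      exact measurable_real_tanh.comp (by fun_prop)
    have : IsProbabilityMeasure (μ.map U) := Measure.isProbabilityMeasure_map hUm.aemeasurable
    have hFint : Integrable F ((μ.map U).prod (gaussianReal m v)) :=
      ((hid.sub (integrable_tanh_mul hid (by fun_prop))).comp_snd _).indicator hTm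
    calc _ = ∫ ω, F (U ω, Y ω) ∂μ := rfl
      _ = ∫ p, F p ∂((μ.map U).prod (gaussianReal m v)) := by
        rw [← hY, ← hindep.map_prod_eq_prod_map_map hUm.aemeasurable hYm.aemeasurable,
          integral_map (by fun_prop) hFm.aestronglyMeasurable]
      _ = ∫ u, ∫ y, F (u, y) ∂gaussianReal m v ∂(μ.map U) := integral_prod _ hFint
      _ = 0 := by
        refine integral_eq_zero_of_ae (ae_of_all _ fun u => ?_)
        have hk : Function.Even fun y : ℝ => T.indicator (fun _ => (1 : ℝ)) (u, y) := fun y => by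
          have h : (u, -y) ∈ T ↔ (u, y) ∈ T := by
            change Real.arctan ((-y) ^ 2) + u * Real.pi ∈ B ↔ Real.arctan (y ^ 2) + u * Real.pi ∈ B
            rw [neg_sq]
          by_cases hy : (u, y) ∈ T
          · simp only [Set.indicator_of_mem hy, Set.indicator_of_mem (h.2 hy)]
          · simp only [Set.indicator_of_notMem hy, Set.indicator_of_notMem (mt h.1 hy)]
        refine Eq.trans ?_ (integral_even_mul_sub_tanh_gaussianReal m hv hk)
        refine integral_congr_ae (ae_of_all _ fun y => ?_)
        simp [F, Set.indicator]
  · refine AEStronglyMeasurable.congr (f := fun ω =>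
      (fun x => Real.tanh (m / v * √(Real.tan x)) * √(Real.tan x))
        (Real.arctan (Y ω ^ 2) + U ω * Real.pi)) ?_ ?_
    · refine StronglyMeasurable.aestronglyMeasurable (Measurable.stronglyMeasurable ?_)
      have h : Measurable fun x => √(Real.tan x) := measurable_real_tan.sqrt
      exact ((measurable_real_tanh.comp (h.const_mul (m / v))).mul h).comp (comap_measurable _)
    · filter_upwards [hU] with ω hω
      have htan : Real.tan (Real.arctan (Y ω ^ 2) + U ω * Real.pi) = Y ω ^ 2 := by
        rcases hω with h | h
        · simp [h]
        · rw [h, one_mul, Real.tan_periodic, Real.tan_arctan]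
      simp only [htan, Real.sqrt_sq_eq_abs]
      rcases abs_choice (Y ω) with h | h <;> rw [h]
      exact even_tanh_mul _ _

/-- In the synthetic example, `ρ(E(Y|X), Y)² = 1 - E[(Y/σ)²(1 - tanh((m/σ²)Y))]`. -/
theorem sq_pearson_condexp_eq {Ω : Type*} [MeasurableSpace Ω] (μ : Measure Ω)
    [IsProbabilityMeasure μ] (Y U : Ω → ℝ) (m σ : ℝ) (hσ : 0 < σ)
    (hYm : Measurable Y) (hUm : Measurable U)
    (hY : μ.map Y = gaussianReal m ⟨σ ^ 2, sq_nonneg σ⟩)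
    (hU : μ.map U = (1/2 : ℝ≥0∞) • Measure.dirac (0 : ℝ) + (1/2 : ℝ≥0∞) • Measure.dirac 1)
    (hindep : IndepFun U Y μ)
    (X : Ω → ℝ) (hX : X = fun ω => Real.arctan ((Y ω) ^ 2) + U ω * Real.pi) :
    (pearson μ (μ[Y | MeasurableSpace.comap X inferInstance]) Y) ^ 2
      = 1 - ∫ ω, (Y ω / σ) ^ 2 * (1 - Real.tanh ((m / σ ^ 2) * Y ω)) ∂μ := by
  subst hX
  set v : ℝ≥0 := ⟨σ ^ 2, sq_nonneg σ⟩
  have hvσ : (v : ℝ) = σ ^ 2 := rfl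
  have hv : v ≠ 0 := by
    rw [← NNReal.coe_ne_zero, hvσ]
    positivity
  have hU01 : ∀ᵐ ω ∂μ, U ω = 0 ∨ U ω = 1 := by
    refine ae_of_ae_map (p := fun u => u = 0 ∨ u = 1) hUm.aemeasurable ?_
    rw [hU, ae_add_measure_iff]
    constructor <;> refine Measure.ae_smul_measure ?_ _ <;> simp [ae_dirac_eq]
  have hZ := condExp_comap_arctan_sq_add hv hYm hUm hY hU01 hindep
  rw [hvσ] at hZ
  set Z : Ω → ℝ := fun ω => Real.tanh (m / σ ^ 2 * Y ω) * Y ω with hZdef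
  have hlaw : HasLaw Y (gaussianReal m v) μ := ⟨hYm.aemeasurable, hY⟩
  have hZm : Measurable Z := (measurable_real_tanh.comp (by fun_prop)).mul hYm
  have hYL : MemLp Y 2 μ := by
    have h := memLp_id_gaussianReal' (μ := m) (v := v) 2 (by simp)
    rw [← hY] at h
    exact h.comp_of_map hYm.aemeasurable
  have hZL : MemLp Z 2 μ := by
    refine hYL.mono hZm.aestronglyMeasurable (ae_of_all _ fun ω => ?_)
    rw [hZdef, norm_mul]
    exact mul_le_of_le_one_left (norm_nonneg _) (Real.abs_tanh_lt_one _).le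
  have hYint := hYL.integrable one_le_two
  have hZint := hZL.integrable one_le_two
  have hZY : Integrable (fun ω => Z ω * Y ω) μ := hZL.integrable_mul hYL
  have hZZ : Integrable (fun ω => Z ω * Z ω) μ := hZL.integrable_mul hZL
  have hYY : Integrable (fun ω => Y ω ^ 2) μ := hYL.integrable_sq
  have htanh : Measurable fun y : ℝ => Real.tanh (m / v * y) :=
    measurable_real_tanh.comp (by fun_prop)
  have hEY : ∫ ω, Y ω ∂μ = m := by
    rw [hlaw.integral_eq, integral_id_gaussianReal]
  have hEYZ : ∫ ω, (Y ω - Z ω) ∂μ = 0 := by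
    have h := integral_even_mul_sub_tanh_gaussianReal m hv (k := fun _ => 1) fun _ => rfl
    rw [← hY, integral_map hYm.aemeasurable (by fun_prop)] at h
    simpa only [one_mul, hvσ] using h
  have hEZ : ∫ ω, Z ω ∂μ = m := by
    rw [integral_sub hYint hZint, hEY] at hEYZ
    linarith
  have hEZZ : ∫ ω, Z ω * Z ω ∂μ = ∫ ω, Z ω * Y ω ∂μ := by
    have h := integral_even_mul_sub_tanh_gaussianReal m hv (even_tanh_mul (m / v))
    rw [← hY, integral_map hYm.aemeasurable (by fun_prop)] at h
    rw [eq_comm, ← sub_eq_zero, ← integral_sub hZY hZZ, ← h]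
    exact integral_congr_ae (ae_of_all _ fun ω => (mul_sub _ _ _).symm)
  have hVY : variance Y μ = σ ^ 2 := by
    rw [hlaw.variance_eq, variance_id_gaussianReal, hvσ]
  have hVZ : variance Z μ = cov μ Z Y := by
    rw [variance_eq_sub hZL, cov, hEZ, hEY, ← hEZZ, sq m]
    simp only [Pi.pow_apply, sq]
  have hEYY : ∫ ω, Y ω ^ 2 ∂μ = σ ^ 2 + m ^ 2 := by
    have h := variance_eq_sub hYL
    rw [hVY, hEY] at h
    simp only [Pi.pow_apply] at h
    linarith
  have hpearson : pearson μ (μ[Y | MeasurableSpace.comap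
      (fun ω => Real.arctan (Y ω ^ 2) + U ω * Real.pi) inferInstance]) Y = pearson μ Z Y := by
    have hmul : (fun ω => Z ω * Y ω) =ᵐ[μ] fun ω => (μ[Y | MeasurableSpace.comap
        (fun ω => Real.arctan (Y ω ^ 2) + U ω * Real.pi) inferInstance]) ω * Y ω := by
      filter_upwards [hZ] with ω hω
      rw [hω]
    rw [pearson, pearson, cov, cov, ← variance_congr hZ, ← integral_congr_ae hZ,
      ← integral_congr_ae hmul]
  have hcov : cov μ Z Y = (∫ ω, Z ω * Y ω ∂μ) - m ^ 2 := by
    rw [cov, hEZ, hEY, sq]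
  have hRHS : ∫ ω, (Y ω / σ) ^ 2 * (1 - Real.tanh (m / σ ^ 2 * Y ω)) ∂μ =
      (σ ^ 2 + m ^ 2 - ∫ ω, Z ω * Y ω ∂μ) / σ ^ 2 := by
    rw [← hEYY, ← integral_sub hYY hZY, ← integral_div]
    refine integral_congr_ae (ae_of_all _ fun ω => ?_)
    simp only [hZdef]
    ring
  rw [hpearson, pearson, hRHS, div_pow, mul_pow, Real.sq_sqrt (variance_nonneg _ _), hVY,
    Real.sq_sqrt (sq_nonneg σ), ← hVZ]
  rw [← hVZ] at hcov
  have hfin : variance Z μ ^ 2 / (variance Z μ * σ ^ 2) = variance Z μ / σ ^ 2 := by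
    rcases eq_or_ne (variance Z μ) 0 with h | h
    · simp [h]
    · field_simp
  rw [hfin, hcov]
  field_simp
  ring
end

section
/- In the setting Y ~ N(μ, σ²), U ~ Bernoulli(1/2) independent of Y, X = arctan(Y²) + Uπ, with α = μ/σ, the correlation ρ(E(Y|X), Y) satisfies √(1 - e^{-α²/2}) ≤ ρ(E(Y|X), Y) ≤ √(1 - e^{-α²/2}(1+α²)^{-3/2}). -/
open MeasureTheory ProbabilityTheory
open scoped NNReal ENNReal

namespace Real

theorem one_sub_tanh (t : ℝ) : 1 - tanh t = exp (-t) / cosh t := by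
  rw [tanh_eq_sinh_div_cosh, ← cosh_sub_sinh, sub_div, div_self (cosh_pos t).ne']

@[fun_prop]
theorem continuous_tanh : Continuous tanh := by
  have h : tanh = fun t => sinh t / cosh t := funext tanh_eq_sinh_div_cosh
  rw [h]
  exact continuous_sinh.div continuous_cosh fun t => (cosh_pos t).ne'

end Real

namespace ProbabilityTheory

theorem gaussianPDFReal_mul_exp_neg {v : ℝ≥0} (hv : v ≠ 0) (m y : ℝ) :
    gaussianPDFReal m v y * Real.exp (-(m * y / v))
      = Real.exp (-m ^ 2 / (2 * v)) * gaussianPDFReal 0 v y := by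
  have hv' : (v : ℝ) ≠ 0 := by exact_mod_cast hv
  simp only [gaussianPDFReal]
  rw [mul_assoc, ← Real.exp_add, mul_left_comm, ← Real.exp_add]
  congr 2
  field_simp
  ring

theorem integral_gaussianReal_mul_one_sub_tanh {v : ℝ≥0} (hv : v ≠ 0) (m : ℝ) (f : ℝ → ℝ) :
    ∫ y, f y * (1 - Real.tanh (m * y / v)) ∂gaussianReal m v
      = Real.exp (-m ^ 2 / (2 * v)) * ∫ y, f y / Real.cosh (m * y / v) ∂gaussianReal 0 v := by
  rw [integral_gaussianReal_eq_integral_smul hv, integral_gaussianReal_eq_integral_smul hv,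
    ← integral_const_mul]
  congr with y
  have h := gaussianPDFReal_mul_exp_neg hv m y
  rw [Real.one_sub_tanh, smul_eq_mul, smul_eq_mul]
  linear_combination (f y / Real.cosh (m * y / v)) * h

theorem integral_gaussianReal_zero_of_odd {v : ℝ≥0} (hv : v ≠ 0) {f : ℝ → ℝ}
    (hf : ∀ y, f (-y) = -f y) : ∫ y, f y ∂gaussianReal 0 v = 0 := by
  rw [integral_gaussianReal_eq_integral_smul hv]
  have h := integral_neg_eq_self (fun y => gaussianPDFReal 0 v y • f y) volume
  have h' : ∀ y, gaussianPDFReal 0 v (-y) • f (-y) = -(gaussianPDFReal 0 v y • f y) := by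
    intro y
    simp [gaussianPDFReal, hf]
  simp only [h', integral_neg] at h
  linarith

theorem integral_gaussianReal_even_mul_sub_tanh {v : ℝ≥0} (hv : v ≠ 0) (m : ℝ) {h : ℝ → ℝ}
    (hh : ∀ y, h (-y) = h y) :
    ∫ y, h y * (y - Real.tanh (m * y / v) * y) ∂gaussianReal m v = 0 := by
  have e : ∀ y, h y * (y - Real.tanh (m * y / v) * y)
      = (h y * y) * (1 - Real.tanh (m * y / v)) := fun y => by ring
  simp only [e]
  rw [integral_gaussianReal_mul_one_sub_tanh hv, integral_gaussianReal_zero_of_odd hv, mul_zero]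
  intro y
  rw [hh, mul_neg m, neg_div, Real.cosh_neg]
  ring

theorem integral_sq_gaussianReal (m : ℝ) (v : ℝ≥0) :
    ∫ y, y ^ 2 ∂gaussianReal m v = v + m ^ 2 := by
  have h := variance_eq_sub (memLp_id_gaussianReal (μ := m) (v := v) 2)
  simp only [variance_id_gaussianReal, Pi.pow_apply, id, integral_id_gaussianReal] at h
  linarith

theorem integrable_sq_gaussianReal (m : ℝ) (v : ℝ≥0) :
    Integrable (fun y => y ^ 2) (gaussianReal m v) :=
  (memLp_id_gaussianReal (μ := m) (v := v) 2).integrable_sq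

theorem integral_sq_mul_exp_gaussianReal {v : ℝ≥0} (hv : v ≠ 0) {b : ℝ} (hb : 0 ≤ b) :
    ∫ y, y ^ 2 * Real.exp (-(b * y ^ 2 / (2 * v))) ∂gaussianReal 0 v
      = v * (1 + b) ^ (-(3 : ℝ) / 2) := by
  have hv' : 0 < (v : ℝ) := by exact_mod_cast pos_iff_ne_zero.mpr hv
  have hb' : 0 < 1 + b := by linarith
  let w : ℝ≥0 := ⟨v / (1 + b), by positivity⟩
  have hw' : (w : ℝ) = v / (1 + b) := rfl
  have hw : w ≠ 0 := by
    rw [← NNReal.coe_ne_zero, hw']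
    positivity
  have key : ∀ y, gaussianPDFReal 0 v y • (y ^ 2 * Real.exp (-(b * y ^ 2 / (2 * v))))
      = (1 + b) ^ (-(1 : ℝ) / 2) * (gaussianPDFReal 0 w y • y ^ 2) := by
    intro y
    have h1 : (1 + b) ^ (-(1 : ℝ) / 2) = (√(1 + b))⁻¹ := by
      rw [neg_div, Real.rpow_neg hb'.le, Real.sqrt_eq_rpow]
    have h2 : √(2 * Real.pi * w) = √(2 * Real.pi * v) / √(1 + b) := by
      rw [hw', ← Real.sqrt_div' _ hb'.le, mul_div_assoc]
    have h3 : Real.exp (-(y - 0) ^ 2 / (2 * w))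
        = Real.exp (-(y - 0) ^ 2 / (2 * v)) * Real.exp (-(b * y ^ 2 / (2 * v))) := by
      rw [← Real.exp_add, hw']
      congr 1
      field_simp
      ring
    have h4 : √(1 + b) ≠ 0 := (Real.sqrt_pos.mpr hb').ne'
    simp only [gaussianPDFReal, smul_eq_mul]
    rw [h1, h2, h3]
    field_simp
  rw [integral_gaussianReal_eq_integral_smul hv]
  simp only [key]
  rw [integral_const_mul, ← integral_gaussianReal_eq_integral_smul hw, integral_sq_gaussianReal,
    hw', show (-(3 : ℝ) / 2) = -(1 : ℝ) / 2 - 1 by norm_num, Real.rpow_sub_one hb'.ne']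
  ring

theorem integrable_sq_div_cosh_gaussianReal (c : ℝ) (v : ℝ≥0) :
    Integrable (fun y => y ^ 2 / Real.cosh (c * y / v)) (gaussianReal 0 v) := by
  refine (integrable_sq_gaussianReal 0 v).mono' ?_ (.of_forall fun y => ?_)
  · exact (Continuous.div (by fun_prop) (by fun_prop)
      fun y => (Real.cosh_pos _).ne').aestronglyMeasurable
  · rw [Real.norm_of_nonneg (by positivity)]
    exact div_le_self (by positivity) (Real.one_le_cosh _)

theorem integral_sq_div_cosh_gaussianReal_le (c : ℝ) (v : ℝ≥0) :
    ∫ y, y ^ 2 / Real.cosh (c * y / v) ∂gaussianReal 0 v ≤ v := by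
  have h := integral_sq_gaussianReal 0 v
  calc _ ≤ ∫ y, y ^ 2 ∂gaussianReal 0 v :=
        integral_mono (integrable_sq_div_cosh_gaussianReal c v) (integrable_sq_gaussianReal 0 v)
          fun y => div_le_self (by positivity) (Real.one_le_cosh _)
    _ = v := by simpa using h

theorem le_integral_sq_div_cosh_gaussianReal (c : ℝ) {v : ℝ≥0} (hv : v ≠ 0) :
    v * (1 + c ^ 2 / v) ^ (-(3 : ℝ) / 2)
      ≤ ∫ y, y ^ 2 / Real.cosh (c * y / v) ∂gaussianReal 0 v := by
  have hv' : (v : ℝ) ≠ 0 := by exact_mod_cast hv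
  rw [← integral_sq_mul_exp_gaussianReal hv (by positivity)]
  have hle : ∀ y : ℝ, y ^ 2 * Real.exp (-(c ^ 2 / v * y ^ 2 / (2 * v)))
      ≤ y ^ 2 / Real.cosh (c * y / v) := by
    intro y
    rw [Real.exp_neg, ← div_eq_mul_inv]
    gcongr
    refine (Real.cosh_le_exp_half_sq _).trans_eq ?_
    congr 1
    field_simp
  refine integral_mono_of_nonneg (.of_forall fun y => by positivity)
    (integrable_sq_div_cosh_gaussianReal c v) (.of_forall hle)

variable {Ω : Type*} [MeasurableSpace Ω] {μ : Measure Ω}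

/-- The conditional expectation of a Gaussian variable `Y` given `Y ^ 2` and an independent
integer-valued variable `U`, the two being encoded as `arctan (Y ^ 2) + U * π`. -/
theorem condExp_gaussian_arctan_sq_add_mul_pi [IsProbabilityMeasure μ] {Y U : Ω → ℝ} {m : ℝ}
    {v : ℝ≥0} (hv : v ≠ 0) (hYm : Measurable Y) (hUm : Measurable U)
    (hY : μ.map Y = gaussianReal m v) (hU : ∀ᵐ ω ∂μ, ∃ n : ℤ, U ω = n) (hindep : IndepFun U Y μ) :
    (fun ω => Real.tanh (m * Y ω / v) * Y ω) =ᵐ[μ]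
      μ[Y | MeasurableSpace.comap (fun ω => Real.arctan (Y ω ^ 2) + U ω * Real.pi)
        inferInstance] := by
  set X : Ω → ℝ := fun ω => Real.arctan (Y ω ^ 2) + U ω * Real.pi with hX
  have hXm : Measurable X := by fun_prop
  have hYint : Integrable Y μ := by
    have h : Integrable (fun y => y) (μ.map Y) := by
      rw [hY]
      exact (memLp_id_gaussianReal 1).integrable le_rfl
    exact h.comp_measurable hYm
  have hTint : Integrable (fun ω => Real.tanh (m * Y ω / v) * Y ω) μ := by
    refine hYint.bdd_mul (c := 1) (by fun_prop) (.of_forall fun ω => ?_)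
    exact (Real.abs_tanh_lt_one _).le
  refine ae_eq_condExp_of_forall_setIntegral_eq hXm.comap_le hYint
    (fun s _ _ => hTint.integrableOn) ?_ ?_
  · rintro s ⟨B, hB, rfl⟩ -
    have hs : MeasurableSet (X ⁻¹' B) := hXm hB
    rw [eq_comm, ← sub_eq_zero, ← integral_sub hYint.integrableOn hTint.integrableOn,
      ← integral_indicator hs]
    let G : ℝ × ℝ → ℝ := fun p =>
      B.indicator (fun _ => (1 : ℝ)) (Real.arctan (p.2 ^ 2) + p.1 * Real.pi)
        * (p.2 - Real.tanh (m * p.2 / v) * p.2)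
    have hG : Measurable G := by
      refine Measurable.mul ?_ (by fun_prop)
      exact (measurable_const.indicator hB).comp
        (f := fun p : ℝ × ℝ => Real.arctan (p.2 ^ 2) + p.1 * Real.pi) (by fun_prop)
    have hGX : (X ⁻¹' B).indicator (fun ω => Y ω - Real.tanh (m * Y ω / v) * Y ω)
        = fun ω => G (U ω, Y ω) := by
      ext ω
      by_cases h : X ω ∈ B
      · have h' : Real.arctan (Y ω ^ 2) + U ω * Real.pi ∈ B := h
        simp [G, Set.indicator, h, h']
      · have h' : Real.arctan (Y ω ^ 2) + U ω * Real.pi ∉ B := h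
        simp [G, Set.indicator, h, h']
    have hUY : Measurable fun ω => (U ω, Y ω) := hUm.prodMk hYm
    have hmap : μ.map (fun ω => (U ω, Y ω)) = (μ.map U).prod (gaussianReal m v) := by
      rw [← hY]
      exact hindep.map_prod_eq_prod_map_map hUm.aemeasurable hYm.aemeasurable
    have hGint : Integrable G ((μ.map U).prod (gaussianReal m v)) := by
      rw [← hmap, integrable_map_measure hG.aestronglyMeasurable hUY.aemeasurable]
      change Integrable (fun ω => G (U ω, Y ω)) μ
      rw [← hGX]
      exact (hYint.sub hTint).indicator hs
    have : IsProbabilityMeasure (μ.map U) := Measure.isProbabilityMeasure_map hUm.aemeasurable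
    rw [hGX, ← integral_map hUY.aemeasurable hG.aestronglyMeasurable, hmap,
      integral_prod _ hGint]
    refine integral_eq_zero_of_ae (.of_forall fun u => ?_)
    exact integral_gaussianReal_even_mul_sub_tanh hv m fun y => by rw [neg_sq]
  · let g : ℝ → ℝ := fun x => Real.tanh (m * √(Real.tan x) / v) * √(Real.tan x)
    have htan : Measurable Real.tan := by
      have h : Real.tan = fun x => Real.sin x / Real.cos x := funext Real.tan_eq_sin_div_cos
      rw [h]
      fun_prop
    have hg : Measurable g := by fun_prop
    refine ⟨g ∘ X, (hg.comp (comap_measurable X)).stronglyMeasurable, ?_⟩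
    filter_upwards [hU] with ω ⟨n, hn⟩
    have h : Real.tan (X ω) = Y ω ^ 2 := by
      rw [hX]
      simp only [hn]
      rw [Real.tan_add_int_mul_pi, Real.tan_arctan]
    simp only [g, Function.comp_apply, h, Real.sqrt_sq_eq_abs]
    rcases abs_choice (Y ω) with h | h <;> rw [h]
    rw [mul_neg m, neg_div, Real.tanh_neg, neg_mul_neg]

end ProbabilityTheory

theorem pearson_congr_left {Ω : Type*} [MeasurableSpace Ω] {μ : Measure Ω} {U U' V : Ω → ℝ}
    (h : U =ᵐ[μ] U') : pearson μ U V = pearson μ U' V := by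
  have h1 : ∫ ω, U ω * V ω ∂μ = ∫ ω, U' ω * V ω ∂μ :=
    integral_congr_ae (h.mono fun ω hω => by simp only [hω])
  rw [pearson, pearson, cov, cov, h1, integral_congr_ae h, variance_congr h]

/-- If `T` satisfies the orthogonality relations of a conditional expectation of `V`, its
correlation with `V` is the square root of the proportion of explained variance. -/
theorem pearson_eq_sqrt_of_orthogonal {Ω : Type*} [MeasurableSpace Ω] {μ : Measure Ω}
    [IsProbabilityMeasure μ] {T V : Ω → ℝ} (hT : MemLp T 2 μ)
    (hmean : ∫ ω, T ω ∂μ = ∫ ω, V ω ∂μ) (horth : ∫ ω, T ω * V ω ∂μ = ∫ ω, T ω ^ 2 ∂μ) :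
    pearson μ T V = √(cov μ T V / variance V μ) := by
  have hc : cov μ T V = variance T μ := by
    rw [variance_eq_sub hT, cov, horth, ← hmean, ← sq]
    rfl
  rw [pearson, hc, ← div_div, Real.div_sqrt, Real.sqrt_div (variance_nonneg _ _)]

/-- Bounds on the simplified maximal correlation: with `α = m/σ`,
`√(1-e^{-α²/2}) ≤ ρ(E(Y|X), Y) ≤ √(1-e^{-α²/2}(1+α²)^{-3/2})`. -/
theorem pearson_condexp_bounds {Ω : Type*} [MeasurableSpace Ω] (μ : Measure Ω)
    [IsProbabilityMeasure μ] (Y U : Ω → ℝ) (m σ : ℝ) (hσ : 0 < σ)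
    (hYm : Measurable Y) (hUm : Measurable U)
    (hY : μ.map Y = gaussianReal m ⟨σ ^ 2, sq_nonneg σ⟩)
    (hU : μ.map U = (1/2 : ℝ≥0∞) • Measure.dirac (0 : ℝ) + (1/2 : ℝ≥0∞) • Measure.dirac 1)
    (hindep : IndepFun U Y μ)
    (X : Ω → ℝ) (hX : X = fun ω => Real.arctan ((Y ω) ^ 2) + U ω * Real.pi)
    (α : ℝ) (hα : α = m / σ) :
    Real.sqrt (1 - Real.exp (-α ^ 2 / 2))
        ≤ pearson μ (μ[Y | MeasurableSpace.comap X inferInstance]) Y ∧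
      pearson μ (μ[Y | MeasurableSpace.comap X inferInstance]) Y
        ≤ Real.sqrt (1 - Real.exp (-α ^ 2 / 2) * (1 + α ^ 2) ^ (-(3 : ℝ) / 2)) := by
  set v : ℝ≥0 := ⟨σ ^ 2, sq_nonneg σ⟩ with hvdef
  have hvσ : (v : ℝ) = σ ^ 2 := rfl
  have hv : v ≠ 0 := by
    rw [← NNReal.coe_ne_zero, hvσ]
    positivity
  have hUint : ∀ᵐ ω ∂μ, ∃ n : ℤ, U ω = n := by
    have h : ∀ᵐ u ∂μ.map U, u = 0 ∨ u = 1 := by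
      rw [hU, ae_add_measure_iff]
      constructor <;> refine Measure.ae_smul_measure ?_ _ <;> simp [ae_dirac_eq]
    filter_upwards [ae_of_ae_map hUm.aemeasurable h] with ω hω
    rcases hω with hω | hω
    · exact ⟨0, by simp [hω]⟩
    · exact ⟨1, by simp [hω]⟩
  have hcond := condExp_gaussian_arctan_sq_add_mul_pi hv hYm hUm hY hUint hindep
  rw [hX, ← pearson_congr_left hcond]
  let t : ℝ → ℝ := fun y => Real.tanh (m * y / v) * y
  have ht : Measurable t := by fun_prop
  have htr : ∀ f : ℝ → ℝ, Measurable f →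
      ∫ ω, f (Y ω) ∂μ = ∫ y, f y ∂gaussianReal m v := fun f hf => by
    rw [← hY, integral_map hYm.aemeasurable hf.aestronglyMeasurable]
  have hid : MemLp (fun y : ℝ => y) 2 (gaussianReal m v) := memLp_id_gaussianReal 2
  have htL : MemLp t 2 (gaussianReal m v) := by
    refine hid.mono ht.aestronglyMeasurable (.of_forall fun y => ?_)
    rw [norm_mul]
    exact mul_le_of_le_one_left (norm_nonneg _) (Real.abs_tanh_lt_one _).le
  have htY : MemLp (fun ω => t (Y ω)) 2 μ := by
    rw [← hY] at htL
    exact htL.comp_of_map hYm.aemeasurable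
  have hmeanY : ∫ ω, Y ω ∂μ = m := by
    rw [htr (fun y => y) measurable_id, integral_id_gaussianReal]
  have hmeanT : ∫ ω, t (Y ω) ∂μ = m := by
    rw [htr t ht]
    have h := integral_gaussianReal_even_mul_sub_tanh hv m (h := fun _ => 1) fun _ => rfl
    simp only [one_mul] at h
    rw [integral_sub (hid.integrable one_le_two) (htL.integrable one_le_two),
      integral_id_gaussianReal] at h
    exact (sub_eq_zero.mp h).symm
  have htid : Integrable (fun y => t y * y) (gaussianReal m v) := htL.integrable_mul hid
  have horth : ∫ ω, t (Y ω) * Y ω ∂μ = ∫ ω, t (Y ω) ^ 2 ∂μ := by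
    rw [htr (fun y => t y * y) (by fun_prop), htr (fun y => t y ^ 2) (by fun_prop),
      ← sub_eq_zero, ← integral_sub htid htL.integrable_sq]
    have h := integral_gaussianReal_even_mul_sub_tanh hv m (h := t) fun y => by
      simp only [t]
      rw [mul_neg m, neg_div, Real.tanh_neg, neg_mul_neg]
    rw [← h]
    congr with y
    simp only [t]
    ring
  have hvar : variance Y μ = σ ^ 2 := by
    rw [← hvσ, ← variance_id_gaussianReal (μ := m) (v := v), ← hY, variance_id_map hYm.aemeasurable]
  set K := ∫ y, y ^ 2 / Real.cosh (m * y / v) ∂gaussianReal 0 v with hK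
  have hexp : Real.exp (-m ^ 2 / (2 * v)) = Real.exp (-α ^ 2 / 2) := by
    rw [hα, hvσ]
    congr 1
    field_simp
  have hcov : cov μ (fun ω => t (Y ω)) Y = σ ^ 2 - Real.exp (-α ^ 2 / 2) * K := by
    have h := integral_gaussianReal_mul_one_sub_tanh hv m (fun y => y ^ 2)
    have e : ∀ y : ℝ, y ^ 2 * (1 - Real.tanh (m * y / v)) = y ^ 2 - t y * y := fun y => by
      simp only [t]
      ring
    simp only [e] at h
    rw [integral_sub (integrable_sq_gaussianReal m v) htid, integral_sq_gaussianReal, hexp,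
      ← hK, hvσ] at h
    rw [cov, hmeanT, hmeanY, htr (fun y => t y * y) (by fun_prop)]
    linarith
  have hKle : K ≤ σ ^ 2 := integral_sq_div_cosh_gaussianReal_le m v
  have hleK : σ ^ 2 * (1 + α ^ 2) ^ (-(3 : ℝ) / 2) ≤ K := by
    have h := le_integral_sq_div_cosh_gaussianReal m hv
    rwa [hvσ, ← div_pow, ← hα] at h
  have hσ2 : 0 < σ ^ 2 := by positivity
  have hE := Real.exp_pos (-α ^ 2 / 2)
  change _ ≤ pearson μ (fun ω => t (Y ω)) Y ∧ pearson μ (fun ω => t (Y ω)) Y ≤ _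
  rw [pearson_eq_sqrt_of_orthogonal htY (hmeanT.trans hmeanY.symm) horth, hcov, hvar]
  constructor <;> apply Real.sqrt_le_sqrt
  · rw [le_div_iff₀ hσ2]
    nlinarith
  · rw [div_le_iff₀ hσ2]
    nlinarith
end
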